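/- arXiv:2511.13472 — 8 statements merged into one kernel-verified Lean document; each statement's English description precedes it below -/
import Mathlib

section
/- Let v_1, …, v_k be pairwise orthogonal nonzero vectors in ℝⁿ with 2 ≤ k ≤ n. Then for every (k−1)-dimensional linear subspace W ⊆ ℝⁿ there exists an index i₀ ∈ {1, …, k} such that ‖v_{i₀} − P_W v_{i₀}‖² ≥ ‖v_{i₀}‖²/k, where P_W denotes the orthogonal projection onto W; equivalently, sin²θ_{i₀} ≥ 1/k where θ_{i₀} is the angle between W and v_{i₀}. -/
open scoped RealInnerProductSpace

/-- Given pairwise orthogonal nonzero vectors `v_1, …, v_k` in `ℝⁿ` with `2 ≤ k ≤ n`, for every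
`(k-1)`-dimensional subspace `W` there is an index `i₀` with
`‖v_{i₀} - P_W v_{i₀}‖² ≥ ‖v_{i₀}‖² / k`, i.e. `sin² θ_{i₀} ≥ 1/k`. -/
theorem exists_projection_dist_sq_ge {n k : ℕ} (hk2 : 2 ≤ k) (hkn : k ≤ n)
    (v : Fin k → EuclideanSpace ℝ (Fin n))
    (hne : ∀ i, v i ≠ 0)
    (horth : ∀ i j, i ≠ j → ⟪v i, v j⟫ = 0)
    (W : Submodule ℝ (EuclideanSpace ℝ (Fin n)))
    (hW : Module.finrank ℝ W = k - 1) :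
    ∃ i₀ : Fin k,
      ‖v i₀‖ ^ 2 / k ≤ ‖v i₀ - (Submodule.orthogonalProjectionOnto W (v i₀) : EuclideanSpace ℝ (Fin n))‖ ^ 2 := by
  by_contra! hcon
  have hk0 : (0:ℝ) < k := by exact_mod_cast (by omega : 0 < k)
  have hpos : ∀ i, 0 < ‖v i‖ := fun i => norm_pos_iff.mpr (hne i)
  set e : Fin k → EuclideanSpace ℝ (Fin n) := fun i => ‖v i‖⁻¹ • v i with he
  have heo : Orthonormal ℝ e := by
    constructor
    · intro i
      simp only [he, norm_smul, norm_inv, norm_norm]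
      exact inv_mul_cancel₀ (hpos i).ne'
    · intro i j hij
      simp [he, inner_smul_left, inner_smul_right, horth i j hij]
  set b := stdOrthonormalBasis ℝ W
  have h1 : ∀ i, ‖W.orthogonalProjectionOnto (e i)‖ ^ 2
      = ∑ j, ‖⟪e i, (b j : EuclideanSpace ℝ (Fin n))⟫‖ ^ 2 := by
    intro i
    rw [← b.sum_sq_norm_inner_right]
    refine Finset.sum_congr rfl fun j _ => ?_
    rw [Submodule.inner_orthogonalProjectionOnto_eq_of_mem_left, real_inner_comm]
  have h2 : ∑ i, ‖W.orthogonalProjectionOnto (e i)‖ ^ 2 ≤ (k:ℝ) - 1 := by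
    simp_rw [h1]
    rw [Finset.sum_comm]
    calc _ ≤ ∑ j, ‖(b j : EuclideanSpace ℝ (Fin n))‖ ^ 2 :=
          Finset.sum_le_sum fun j _ => heo.sum_inner_products_le _
      _ = ∑ j : Fin (Module.finrank ℝ W), (1:ℝ) := by
          refine Finset.sum_congr rfl fun j _ => ?_
          have := b.norm_eq_one j
          rw [Submodule.coe_norm] at this
          rw [this, one_pow]
      _ = (k:ℝ) - 1 := by
          simp [hW, Nat.cast_sub (by omega : 1 ≤ k)]
  have h3 : ∀ i, 1 - 1 / (k:ℝ) < ‖W.orthogonalProjectionOnto (e i)‖ ^ 2 := by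
    intro i
    have hp : ‖v i‖ ^ 2 = ‖W.orthogonalProjectionOnto (v i)‖ ^ 2
        + ‖v i - (W.orthogonalProjectionOnto (v i) : EuclideanSpace ℝ (Fin n))‖ ^ 2 := by
      have h0 : ⟪v i - (W.orthogonalProjectionOnto (v i) : EuclideanSpace ℝ (Fin n)),
          (W.orthogonalProjectionOnto (v i) : EuclideanSpace ℝ (Fin n))⟫ = 0 :=
        Submodule.starProjection_inner_eq_zero _ _ (Submodule.coe_mem _)
      have := norm_add_sq_real (W.orthogonalProjectionOnto (v i) : EuclideanSpace ℝ (Fin n))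
        (v i - (W.orthogonalProjectionOnto (v i) : EuclideanSpace ℝ (Fin n)))
      rw [add_sub_cancel, real_inner_comm, h0] at this
      simpa using this
    have hc := hcon i
    have hpv := hpos i
    simp only [he, map_smul, norm_smul, norm_inv, norm_norm, mul_pow, inv_pow]
    rw [← div_eq_inv_mul, lt_div_iff₀ (by positivity)]
    have : (1 - 1 / (k:ℝ)) * ‖v i‖ ^ 2 = ‖v i‖ ^ 2 - ‖v i‖ ^ 2 / k := by ring
    linarith
  have h4 : ∑ i : Fin k, (1 - 1 / (k:ℝ)) < ∑ i, ‖W.orthogonalProjectionOnto (e i)‖ ^ 2 :=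
    Finset.sum_lt_sum_of_nonempty ⟨⟨0, by omega⟩, Finset.mem_univ _⟩ fun i _ => h3 i
  have h5 : ∑ i : Fin k, (1 - 1 / (k:ℝ)) = k - 1 := by
    rw [Finset.sum_const, Finset.card_univ, Fintype.card_fin, nsmul_eq_mul]
    field_simp
  linarith
end

section
/- Let v_1, …, v_k be orthonormal vectors in ℝⁿ with 1 ≤ k ≤ n, and let J ⊆ {1, …, n} be a set of coordinates with |J| = n − k + 1. Then ∑_{i=1}^{k} ∑_{j ∈ J} v_i(j)² ≥ 1. In particular, there exists i₀ with ∑_{j ∈ J} v_{i₀}(j)² ≥ 1/k. -/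
open Finset

/-- Given orthonormal vectors `v_1, …, v_k` in `ℝⁿ` with `1 ≤ k ≤ n` and a set `J` of
coordinates with `|J| = n - k + 1`, we have `∑_{i} ∑_{j ∈ J} v_i(j)² ≥ 1`; in particular
some `i₀` satisfies `∑_{j ∈ J} v_{i₀}(j)² ≥ 1/k`. -/
theorem sum_sq_coords_ge_one {n k : ℕ} (hk1 : 1 ≤ k) (hkn : k ≤ n)
    (v : Fin k → EuclideanSpace ℝ (Fin n))
    (hv : Orthonormal ℝ v)
    (J : Finset (Fin n)) (hJ : J.card = n - k + 1) :
    (1 : ℝ) ≤ ∑ i : Fin k, ∑ j ∈ J, v i j ^ 2 ∧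
      ∃ i₀ : Fin k, (1 : ℝ) / k ≤ ∑ j ∈ J, v i₀ j ^ 2 := by
  have hcol : ∀ j : Fin n, ∑ i : Fin k, v i j ^ 2 ≤ 1 := by
    intro j
    have h := hv.sum_inner_products_le (EuclideanSpace.single j (1 : ℝ)) (s := Finset.univ)
    simpa [EuclideanSpace.inner_single_right] using h
  have hrow : ∀ i : Fin k, ∑ j : Fin n, v i j ^ 2 = 1 := by
    intro i
    have h := EuclideanSpace.real_norm_sq_eq (v i)
    rw [hv.1 i] at h
    linarith
  have htot : ∑ j : Fin n, ∑ i : Fin k, v i j ^ 2 = k := by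
    rw [Finset.sum_comm]
    simp [hrow]
  have hsplit := Finset.sum_add_sum_compl J (fun j => ∑ i : Fin k, v i j ^ 2)
  have hcompl : ∑ j ∈ Jᶜ, ∑ i : Fin k, v i j ^ 2 ≤ (Jᶜ.card : ℝ) := by
    have h := Finset.sum_le_sum (s := Jᶜ) (fun j _ => hcol j)
    simpa using h
  have hcard : Jᶜ.card + 1 = k := by
    rw [Finset.card_compl, Fintype.card_fin]
    omega
  have hcard' : (Jᶜ.card : ℝ) + 1 = k := by exact_mod_cast hcard
  have hmain : (1 : ℝ) ≤ ∑ i : Fin k, ∑ j ∈ J, v i j ^ 2 := by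
    rw [Finset.sum_comm]
    linarith
  refine ⟨hmain, ?_⟩
  by_contra! hcon
  have hk0 : (k : ℝ) ≠ 0 := by
    have : k ≠ 0 := by omega
    exact_mod_cast this
  have hlt : ∑ i : Fin k, ∑ j ∈ J, v i j ^ 2 < ∑ _i : Fin k, (1 : ℝ) / k :=
    Finset.sum_lt_sum_of_nonempty ⟨⟨0, by omega⟩, Finset.mem_univ _⟩ (fun i _ => hcon i)
  have h1 : ∑ _i : Fin k, (1 : ℝ) / k = 1 := by
    simp [hk0]
  linarith
end

section
/- Let G = (V, E) be a finite simple connected graph with boundary B and let 2 ≤ k ≤ |B|. Suppose v_1, …, v_k ∈ ℝ^V are vectors such that supp(v_i) ∩ B ≠ ∅ for every i and supp(v_i) ∩ supp(v_j) = ∅ for all 1 ≤ i < j ≤ k. Then σ_k / k ≤ max_{1 ≤ i ≤ k} R(v_i). -/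
open Finset
open scoped ENNReal

variable {V : Type*}

/-- The Dirichlet energy `∑_{{u,v}∈E} (f u - f v)^2`. -/
noncomputable def energy [Fintype V] [DecidableEq V] (G : SimpleGraph V) [DecidableRel G.Adj]
    (f : V → ℝ) : ℝ :=
  ∑ e ∈ G.edgeFinset, Sym2.lift ⟨fun u v => (f u - f v) ^ 2, fun u v => by ring⟩ e

/-- The Rayleigh quotient, valued in `ℝ≥0∞`, equal to `+∞` when `f` vanishes on `B`. -/
noncomputable def rayleigh [Fintype V] [DecidableEq V] (G : SimpleGraph V) [DecidableRel G.Adj]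
    (B : Finset V) (f : V → ℝ) : ℝ≥0∞ :=
  if ∀ x ∈ B, f x = 0 then ⊤
  else ENNReal.ofReal (energy G f / ∑ x ∈ B, f x ^ 2)

/-- The `k`-th Steklov eigenvalue via the variational (min-max) characterization:
`σ_k = min over k-dimensional subspaces W of ℝ^V of max_{0 ≠ f ∈ W} R(f)`. -/
noncomputable def steklov [Fintype V] [DecidableEq V] (G : SimpleGraph V) [DecidableRel G.Adj]
    (B : Finset V) (k : ℕ) : ℝ≥0∞ :=
  ⨅ (W : Submodule ℝ (V → ℝ)) (_ : Module.finrank ℝ W = k),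
    ⨆ (f : V → ℝ) (_ : f ∈ W ∧ f ≠ 0), rayleigh G B f

/-- `B` is a boundary of `G`: `|B| ≥ 2` and `∂(V ∖ B) = B`. -/
def IsBoundary [Fintype V] (G : SimpleGraph V) (B : Finset V) : Prop :=
  2 ≤ B.card ∧ ∀ x ∈ B, ∃ y, y ∉ B ∧ G.Adj x y

theorem aux_energy_le [Fintype V] [DecidableEq V] (G : SimpleGraph V) [DecidableRel G.Adj]
    (k : ℕ) (v : Fin k → (V → ℝ)) (c : Fin k → ℝ) :
    energy G (∑ i, c i • v i) ≤ k * ∑ i, c i ^ 2 * energy G (v i) := by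
  unfold energy
  simp_rw [Finset.mul_sum]
  rw [Finset.sum_comm]
  refine Finset.sum_le_sum fun e _ => ?_
  induction e using Sym2.ind with
  | _ a b =>
    simp only [Sym2.lift_mk, Finset.sum_apply, Pi.smul_apply, smul_eq_mul]
    rw [← Finset.sum_sub_distrib]
    refine (sq_sum_le_card_mul_sum_sq).trans (le_of_eq ?_)
    rw [Finset.card_univ, Fintype.card_fin, Finset.mul_sum]
    refine Finset.sum_congr rfl fun i _ => ?_
    ring

theorem aux_apply (k : ℕ) (v : Fin k → (V → ℝ))
    (hdisj : ∀ i j, i ≠ j → ∀ x, v i x = 0 ∨ v j x = 0) (c : Fin k → ℝ) (i : Fin k) (x : V)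
    (hx : v i x ≠ 0) : (∑ i, c i • v i) x = c i * v i x := by
  rw [Finset.sum_apply, Finset.sum_eq_single i]
  · simp
  · intro j _ hj
    have := (hdisj i j hj.symm x).resolve_left hx
    simp [this]
  · simp

theorem aux_sq (k : ℕ) (v : Fin k → (V → ℝ))
    (hdisj : ∀ i j, i ≠ j → ∀ x, v i x = 0 ∨ v j x = 0) (c : Fin k → ℝ) (x : V) :
    ((∑ i, c i • v i) x) ^ 2 = ∑ i, c i ^ 2 * v i x ^ 2 := by
  by_cases h : ∃ i, v i x ≠ 0
  · obtain ⟨i, hi⟩ := h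
    rw [aux_apply k v hdisj c i x hi, Finset.sum_eq_single i]
    · ring
    · intro j _ hj
      have := (hdisj i j hj.symm x).resolve_left hi
      simp [this]
    · simp
  · push Not at h
    simp [h]

/-- If `v_1, …, v_k` have supports meeting `B` and pairwise disjoint supports, then
`σ_k / k ≤ max_i R(v_i)`. -/
theorem steklov_div_le_max_rayleigh [Fintype V] [DecidableEq V]
    (G : SimpleGraph V) [DecidableRel G.Adj] (hG : G.Connected)
    (B : Finset V) (hB : IsBoundary G B)
    (k : ℕ) (hk2 : 2 ≤ k) (hkB : k ≤ B.card)
    (v : Fin k → (V → ℝ))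
    (hsupp : ∀ i, ∃ x ∈ B, v i x ≠ 0)
    (hdisj : ∀ i j, i ≠ j → ∀ x, v i x = 0 ∨ v j x = 0) :
    steklov G B k / (k : ℝ≥0∞) ≤ ⨆ i, rayleigh G B (v i) := by
  have hkey : ∀ c : Fin k → ℝ, (∀ x ∈ B, (∑ i, c i • v i) x = 0) → ∀ i, c i = 0 := by
    intro c hc i
    obtain ⟨x, hx, hvx⟩ := hsupp i
    have := hc x hx
    rw [aux_apply k v hdisj c i x hvx] at this
    exact (mul_eq_zero.mp this).resolve_right hvx
  have hli : LinearIndependent ℝ v := by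
    rw [Fintype.linearIndependent_iff]
    intro c hc
    exact hkey c (fun x _ => by rw [hc]; rfl)
  have hnot : ∀ i, ¬ ∀ x ∈ B, v i x = 0 := by
    intro i h
    obtain ⟨x, hx, hvx⟩ := hsupp i
    exact hvx (h x hx)
  have hpos : ∀ f : V → ℝ, (¬ ∀ x ∈ B, f x = 0) → 0 < ∑ x ∈ B, f x ^ 2 := by
    intro f hf
    push Not at hf
    obtain ⟨x, hx, h⟩ := hf
    exact Finset.sum_pos' (fun _ _ => sq_nonneg _) ⟨x, hx, by positivity⟩
  set S := ⨆ i, rayleigh G B (v i) with hS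
  by_cases hT : S = ⊤
  · rw [hT]; exact le_top
  have hE : ∀ i, energy G (v i) ≤ S.toReal * ∑ x ∈ B, v i x ^ 2 := by
    intro i
    have h1 : rayleigh G B (v i) ≤ S := le_iSup (fun i => rayleigh G B (v i)) i
    unfold rayleigh at h1
    rw [if_neg (hnot i), ENNReal.ofReal_le_iff_le_toReal hT] at h1
    exact (div_le_iff₀ (hpos _ (hnot i))).mp h1
  refine ENNReal.div_le_of_le_mul ?_
  unfold steklov
  refine iInf₂_le_of_le (Submodule.span ℝ (Set.range v)) ?_ ?_
  · rw [finrank_span_eq_card hli, Fintype.card_fin]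
  refine iSup₂_le ?_
  rintro f ⟨hf, hf0⟩
  obtain ⟨c, rfl⟩ := (Submodule.mem_span_range_iff_exists_fun ℝ).mp hf
  have hfB : ¬ ∀ x ∈ B, (∑ i, c i • v i) x = 0 := by
    intro h
    apply hf0
    simp [hkey c h]
  unfold rayleigh
  rw [if_neg hfB, ENNReal.ofReal_le_iff_le_toReal (ENNReal.mul_ne_top hT (by simp)),
    div_le_iff₀ (hpos _ hfB), ENNReal.toReal_mul, ENNReal.toReal_natCast]
  refine (aux_energy_le G k v c).trans ?_
  simp_rw [aux_sq k v hdisj c]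
  rw [Finset.sum_comm, mul_comm S.toReal, mul_assoc]
  refine mul_le_mul_of_nonneg_left ?_ (Nat.cast_nonneg k)
  rw [Finset.mul_sum]
  refine Finset.sum_le_sum fun i _ => ?_
  rw [← Finset.mul_sum, mul_left_comm]
  exact mul_le_mul_of_nonneg_left (hE i) (sq_nonneg _)
end

section
/- Let G = (V, E) be a finite simple connected graph with boundary B and maximum degree D. Let 0 < δ < 1 and 2 ≤ k ≤ δ|B|/4, set r = ⌊δ|B|/4k⌋, and let ω : V → ℝ_{≥0} be a vertex weight with ∑_{v∈V} ω(v)² = 1 that is (r, ε, B)-spreading for some ε > 0. If the finite semi-metric space (V, d_ω) admits an (ε/2)-bounded (α, δ)-padded random partition, then σ_k ≤ (64k/δ)·(D/|B|)·(α/ε)². -/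
open Finset
open scoped ENNReal

variable {V : Type*}

/-- The semi-metric induced by a vertex weight `ω`:
`d_ω(u,v) = min over paths p from u to v of ∑_{x ∈ p} ω(x)`. -/
noncomputable def dOmega (G : SimpleGraph V) (ω : V → ℝ) (u v : V) : ℝ :=
  sInf {s | ∃ p : G.Walk u v, p.IsPath ∧ s = (p.support.map ω).sum}

/-- `ω` is `(r, ε, B)`-spreading: for every `S ⊆ B` with `|S| = r`,
`(1/|S|²) ∑_{u,v ∈ S} d_ω(u,v) ≥ ε √(∑_v ω(v)²)`. -/
def Spreading [Fintype V] [DecidableEq V] (G : SimpleGraph V) (B : Finset V) (ω : V → ℝ)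
    (r : ℕ) (ε : ℝ) : Prop :=
  ∀ S ⊆ B, S.card = r →
    ε * Real.sqrt (∑ x : V, ω x ^ 2) ≤
      (1 / (S.card : ℝ) ^ 2) * ∑ u ∈ S, ∑ v ∈ S, dOmega G ω u v

/-- `ε_r(G, B, ω)`: the maximal `ε` for which `ω` is `(r, ε, B)`-spreading. -/
noncomputable def epsSpread [Fintype V] [DecidableEq V] (G : SimpleGraph V) (B : Finset V)
    (ω : V → ℝ) (r : ℕ) : ℝ :=
  sSup {ε | Spreading G B ω r ε}

/-- `P : X → Finset X` represents a partition of `X`: `P x` is the part containing `x`. -/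
def IsPartitionMap {X : Type*} (P : X → Finset X) : Prop :=
  (∀ x, x ∈ P x) ∧ ∀ x y, y ∈ P x → P y = P x

/-- `ν` is a `κ`-bounded `(α, δ)`-padded random partition of the finite semi-metric space
`(X, d)`: `ν` is a probability distribution supported on partitions of `X`, every part of every
partition in the support has diameter at most `κ`, and for every `x`,
`ℙ_{P∼ν}[B(x, κ/α) ⊆ P(x)] ≥ δ`. -/
def IsPaddedRandomPartition {X : Type*} [Fintype X] [DecidableEq X] (d : X → X → ℝ)
    (κ α δ : ℝ) (ν : (X → Finset X) → ℝ) : Prop :=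
  (∀ P, 0 ≤ ν P) ∧ (∑ P : X → Finset X, ν P) = 1 ∧
    (∀ P, ν P ≠ 0 → IsPartitionMap P) ∧
    (∀ P, ν P ≠ 0 → ∀ x y z : X, y ∈ P x → z ∈ P x → d y z ≤ κ) ∧
    (∀ x : X, δ ≤ ∑ P : X → Finset X,
      if ∀ y, d x y ≤ κ / α → y ∈ P x then ν P else 0)

section Helpers

lemma aux_dOmega_le_walk [DecidableEq V] (G : SimpleGraph V) (ω : V → ℝ) (hω : ∀ x, 0 ≤ ω x)
    {u v : V} (p : G.Walk u v) : dOmega G ω u v ≤ (p.support.map ω).sum := by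
  have h1 : dOmega G ω u v ≤ (p.bypass.support.map ω).sum := by
    apply csInf_le
    · refine ⟨0, ?_⟩
      rintro s ⟨q, -, rfl⟩
      apply List.sum_nonneg
      intro x hx
      obtain ⟨y, -, rfl⟩ := List.mem_map.1 hx
      exact hω y
    · exact ⟨p.bypass, p.bypass_isPath, rfl⟩
  refine h1.trans ?_
  have hsub : p.bypass.support.Subperm p.support :=
    List.subperm_of_subset p.bypass_isPath.support_nodup p.support_bypass_subset
  obtain ⟨l, hl, hs⟩ := hsub
  rw [← (hl.map ω).sum_eq]
  apply List.Sublist.sum_le_sum (hs.map ω)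
  intro x hx
  obtain ⟨y, -, rfl⟩ := List.mem_map.1 hx
  exact hω y

lemma aux_dOmega_adj [DecidableEq V] (G : SimpleGraph V) (ω : V → ℝ) (hω : ∀ x, 0 ≤ ω x)
    {u v : V} (h : G.Adj u v) : dOmega G ω u v ≤ ω u + ω v := by
  have := aux_dOmega_le_walk G ω hω h.toWalk
  simpa using this

lemma aux_dOmega_step [DecidableEq V] (G : SimpleGraph V) (hG : G.Connected)
    (ω : V → ℝ) (hω : ∀ x, 0 ≤ ω x)
    {u v : V} (h : G.Adj u v) (y : V) : dOmega G ω u y ≤ ω u + dOmega G ω v y := by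
  have : dOmega G ω u y - ω u ≤ dOmega G ω v y := by
    apply le_csInf
    · obtain ⟨p, hp⟩ := (hG v y).exists_isPath
      exact ⟨_, p, hp, rfl⟩
    · rintro s ⟨p, -, rfl⟩
      have := aux_dOmega_le_walk G ω hω (SimpleGraph.Walk.cons h p)
      simp at this
      linarith
  linarith

lemma aux_dOmega_symm (G : SimpleGraph V) (ω : V → ℝ) (u v : V) :
    dOmega G ω u v = dOmega G ω v u := by
  have key : ∀ a b : V, {s | ∃ p : G.Walk a b, p.IsPath ∧ s = (p.support.map ω).sum} ⊆
      {s | ∃ p : G.Walk b a, p.IsPath ∧ s = (p.support.map ω).sum} := by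
    rintro a b s ⟨p, hp, rfl⟩
    refine ⟨p.reverse, hp.reverse, ?_⟩
    rw [SimpleGraph.Walk.support_reverse, List.map_reverse, List.sum_reverse]
  unfold dOmega
  rw [Set.Subset.antisymm (key u v) (key v u)]

/-- Modified distance, vanishing on the diagonal. -/
noncomputable def dZ [DecidableEq V] (G : SimpleGraph V) (ω : V → ℝ) (u v : V) : ℝ :=
  if u = v then 0 else dOmega G ω u v

lemma aux_dOmega_nonneg (G : SimpleGraph V) (ω : V → ℝ) (hω : ∀ x, 0 ≤ ω x) (u v : V) :
    0 ≤ dOmega G ω u v := by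
  apply Real.sInf_nonneg
  rintro s ⟨q, -, rfl⟩
  apply List.sum_nonneg
  intro x hx
  obtain ⟨y, -, rfl⟩ := List.mem_map.1 hx
  exact hω y

lemma aux_dZ_step [DecidableEq V] (G : SimpleGraph V) (hG : G.Connected)
    (ω : V → ℝ) (hω : ∀ x, 0 ≤ ω x)
    {u v : V} (h : G.Adj u v) (y : V) : dZ G ω u y ≤ dZ G ω v y + (ω u + ω v) := by
  have h1 := hω u
  have h2 := hω v
  have h3 := aux_dOmega_nonneg G ω hω v y
  have h4 := aux_dOmega_step G hG ω hω h y
  have h5 := aux_dOmega_adj G ω hω h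
  unfold dZ
  split_ifs with ha hb hb
  · linarith
  · linarith
  · subst hb; linarith
  · linarith

/-- The bump function around a finite set. -/
noncomputable def bump [DecidableEq V] (G : SimpleGraph V) (ω : V → ℝ) (c : ℝ)
    (T : Finset V) (hT : T.Nonempty) (x : V) : ℝ :=
  T.sup' hT (fun y => max 0 (1 - dZ G ω x y / c))

lemma aux_bump_step [DecidableEq V] (G : SimpleGraph V) (hG : G.Connected)
    (ω : V → ℝ) (hω : ∀ x, 0 ≤ ω x) (c : ℝ) (hc : 0 < c) (T : Finset V) (hT : T.Nonempty)
    {u v : V} (h : G.Adj u v) :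
    bump G ω c T hT u ≤ bump G ω c T hT v + (ω u + ω v) / c := by
  unfold bump
  apply Finset.sup'_le
  intro y hy
  have h1 : max 0 (1 - dZ G ω v y / c) ≤ T.sup' hT (fun y => max 0 (1 - dZ G ω v y / c)) :=
    Finset.le_sup' (fun y => max 0 (1 - dZ G ω v y / c)) hy
  have h2 : dZ G ω v y / c ≤ dZ G ω u y / c + (ω u + ω v) / c := by
    rw [← add_div]
    have := aux_dZ_step G hG ω hω h.symm y
    gcongr
    linarith
  have h3 : 0 ≤ (ω u + ω v) / c := div_nonneg (add_nonneg (hω u) (hω v)) hc.le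
  have h4 := le_max_left 0 (1 - dZ G ω v y / c)
  have h5 := le_max_right 0 (1 - dZ G ω v y / c)
  apply max_le <;> linarith

lemma aux_bump_sq [DecidableEq V] (G : SimpleGraph V) (hG : G.Connected)
    (ω : V → ℝ) (hω : ∀ x, 0 ≤ ω x) (c : ℝ) (hc : 0 < c) (T : Finset V) (hT : T.Nonempty)
    {u v : V} (h : G.Adj u v) :
    (bump G ω c T hT u - bump G ω c T hT v) ^ 2 ≤ 2 * (ω u ^ 2 + ω v ^ 2) / c ^ 2 := by
  have h1 := aux_bump_step G hG ω hω c hc T hT h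
  have h2 := aux_bump_step G hG ω hω c hc T hT h.symm
  have h3 : (bump G ω c T hT u - bump G ω c T hT v) ^ 2 ≤ ((ω u + ω v) / c) ^ 2 := by
    apply sq_le_sq'
    · rw [add_comm (ω u)]; linarith
    · linarith
  refine h3.trans ?_
  rw [div_pow]
  gcongr
  nlinarith [sq_nonneg (ω u - ω v)]

lemma aux_bump_supp [DecidableEq V] (G : SimpleGraph V)
    (ω : V → ℝ) (c : ℝ) (hc : 0 < c) (T : Finset V) (hT : T.Nonempty)
    {x : V} (h : bump G ω c T hT x ≠ 0) : ∃ y ∈ T, x = y ∨ dOmega G ω y x ≤ c := by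
  by_contra! hcon
  apply h
  unfold bump
  apply le_antisymm
  · apply Finset.sup'_le
    intro y hy
    obtain ⟨h1, h2⟩ := hcon y hy
    apply max_le le_rfl
    rw [aux_dOmega_symm] at h2
    have : 1 ≤ dZ G ω x y / c := by
      rw [le_div_iff₀ hc]; unfold dZ; rw [if_neg h1]; linarith
    linarith
  · obtain ⟨y, hy⟩ := hT
    exact (le_max_left 0 (1 - dZ G ω x y / c)).trans
      (Finset.le_sup' (fun y => max 0 (1 - dZ G ω x y / c)) hy)

lemma aux_bump_one [DecidableEq V] (G : SimpleGraph V)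
    (ω : V → ℝ) (c : ℝ) (T : Finset V) (hT : T.Nonempty)
    {x : V} (h : x ∈ T) : 1 ≤ bump G ω c T hT x := by
  refine le_trans ?_ (Finset.le_sup' (fun y => max 0 (1 - dZ G ω x y / c)) h)
  simp [dZ]

lemma aux_edge_sum [Fintype V] [DecidableEq V] (G : SimpleGraph V) [DecidableRel G.Adj]
    (ω : V → ℝ) (K : ℝ) (hK : 0 ≤ K) (F : V → ℝ)
    (hF : ∀ u v, G.Adj u v → (F u - F v) ^ 2 ≤ K * (ω u ^ 2 + ω v ^ 2)) :
    energy G F ≤ K * (G.maxDegree * ∑ x, ω x ^ 2) := by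
  have h1 : energy G F ≤ ∑ e ∈ G.edgeFinset, K * ∑ x, if x ∈ e then ω x ^ 2 else 0 := by
    unfold energy
    apply Finset.sum_le_sum
    intro e he
    induction e using Sym2.ind with
    | _ u v =>
      have hadj : G.Adj u v := by simpa using he
      simp only [Sym2.lift_mk]
      refine (hF u v hadj).trans ?_
      apply mul_le_mul_of_nonneg_left _ hK
      rw [← Finset.sum_pair (f := fun x => ω x ^ 2) hadj.ne, ← Finset.sum_filter]
      apply Finset.sum_le_sum_of_subset_of_nonneg
      · intro x hx
        simpa using hx
      · intros; positivity
  refine h1.trans ?_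
  rw [← Finset.mul_sum, Finset.sum_comm]
  apply mul_le_mul_of_nonneg_left _ hK
  rw [Finset.mul_sum]
  apply Finset.sum_le_sum
  intro x _
  rw [← Finset.sum_filter, Finset.sum_const, nsmul_eq_mul]
  apply mul_le_mul_of_nonneg_right _ (sq_nonneg _)
  rw [← G.incidenceFinset_eq_filter, G.card_incidenceFinset_eq_degree]
  exact_mod_cast G.degree_le_maxDegree x

lemma aux_take {ι : Type*} [DecidableEq ι] (w : ι → ℝ) (c : ℝ) (hc : 0 ≤ c)
    (s : Finset ι) (hw : ∀ i ∈ s, w i ≤ c) (hs : c ≤ ∑ i ∈ s, w i) :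
    ∃ t ⊆ s, c ≤ ∑ i ∈ t, w i ∧ ∑ i ∈ t, w i ≤ 2 * c := by
  induction s using Finset.induction_on with
  | empty => exact ⟨∅, by simp, hs, by simpa using hc⟩
  | insert a s ha ih =>
    by_cases h : c ≤ ∑ i ∈ s, w i
    · obtain ⟨t, ht, h1⟩ := ih (fun i hi => hw i (Finset.mem_insert_of_mem hi)) h
      exact ⟨t, ht.trans (Finset.subset_insert _ _), h1⟩
    · refine ⟨insert a s, subset_rfl, hs, ?_⟩
      rw [Finset.sum_insert ha]
      have := hw a (Finset.mem_insert_self _ _)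
      push Not at h
      linarith

lemma aux_group {ι : Type*} [DecidableEq ι] (w : ι → ℝ) (c : ℝ) (hc : 0 ≤ c) (k : ℕ) :
    ∀ (s : Finset ι), (∀ i ∈ s, w i ≤ c) → (2 * k * c ≤ ∑ i ∈ s, w i) →
    ∃ T : Fin k → Finset ι, (∀ i, T i ⊆ s) ∧ (∀ i, c ≤ ∑ j ∈ T i, w j) ∧
      ∀ i j, ∀ x, x ∈ T i → x ∈ T j → i = j := by
  induction k with
  | zero => intro s _ _; exact ⟨fun _ => ∅, by simp, fun i => i.elim0, fun i => i.elim0⟩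
  | succ k ih =>
    intro s hw hs
    push_cast at hs
    have hkc : 0 ≤ k * c := by positivity
    obtain ⟨t, ht, h1, h2⟩ := aux_take w c hc s hw (by linarith)
    have h3 := Finset.sum_sdiff (f := w) ht
    obtain ⟨T, hT1, hT2, hT3⟩ := ih (s \ t)
      (fun i hi => hw i (Finset.sdiff_subset hi)) (by linarith)
    have hd : ∀ i x, x ∈ T i → x ∉ t := fun i x hx => (Finset.mem_sdiff.1 (hT1 i hx)).2
    refine ⟨Fin.cons t T, ?_, ?_, ?_⟩
    · intro i; refine Fin.cases ?_ ?_ i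
      · simpa using ht
      · intro i; simpa using (hT1 i).trans Finset.sdiff_subset
    · intro i; refine Fin.cases ?_ ?_ i
      · simpa using h1
      · intro i; simpa using hT2 i
    · intro i j x
      refine Fin.cases ?_ ?_ i <;> refine Fin.cases ?_ ?_ j
      · simp
      · intro j h4 h5; exact absurd (by simpa using h4) (hd j x (by simpa using h5))
      · intro j h4 h5; exact absurd (by simpa using h5) (hd j x (by simpa using h4))
      · intro j i h4 h5
        rw [hT3 i j x (by simpa using h4) (by simpa using h5)]

lemma aux_two {ι : Type*} [Fintype ι] [DecidableEq ι] (a g h : ι → ℝ)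
    (hg : ∀ i j, g i ≠ 0 → g j ≠ 0 → i = j) (hh : ∀ i j, h i ≠ 0 → h j ≠ 0 → i = j) :
    ((∑ i, a i * g i) - ∑ i, a i * h i) ^ 2 ≤ 2 * ∑ i, a i ^ 2 * (g i - h i) ^ 2 := by
  classical
  set s : Finset ι := univ.filter (fun i => g i ≠ 0) ∪ univ.filter (fun i => h i ≠ 0) with hsdef
  have hs : s.card ≤ 2 := by
    refine (Finset.card_union_le _ _).trans ?_
    have h1 : (univ.filter (fun i => g i ≠ 0)).card ≤ 1 := by
      rw [Finset.card_le_one]; intro i hi j hj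
      exact hg i j (by simpa using hi) (by simpa using hj)
    have h2 : (univ.filter (fun i => h i ≠ 0)).card ≤ 1 := by
      rw [Finset.card_le_one]; intro i hi j hj
      exact hh i j (by simpa using hi) (by simpa using hj)
    omega
  have h0 : (∑ i, a i * g i) - ∑ i, a i * h i = ∑ i ∈ s, a i * (g i - h i) := by
    rw [← Finset.sum_sub_distrib]
    symm
    rw [Finset.sum_subset (Finset.subset_univ s)]
    · exact Finset.sum_congr rfl fun i _ => by ring
    · intro i _ hi
      simp [hsdef] at hi
      simp [hi.1, hi.2]
  rw [h0]
  refine sq_sum_le_card_mul_sum_sq.trans ?_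
  have h3 : ∑ i ∈ s, (a i * (g i - h i)) ^ 2 ≤ ∑ i, a i ^ 2 * (g i - h i) ^ 2 := by
    simp_rw [mul_pow]
    exact Finset.sum_le_sum_of_subset_of_nonneg (Finset.subset_univ s)
      (fun i _ _ => by positivity)
  have h4 : (s.card : ℝ) ≤ 2 := by exact_mod_cast hs
  have h5 : 0 ≤ ∑ i ∈ s, (a i * (g i - h i)) ^ 2 := Finset.sum_nonneg fun i _ => sq_nonneg _
  nlinarith

/-- Test functions with disjoint supports bound the Steklov eigenvalue. -/
lemma aux_steklov [Fintype V] [DecidableEq V] (G : SimpleGraph V) [DecidableRel G.Adj]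
    (B : Finset V) (k : ℕ) (ω : V → ℝ) (hnorm : (∑ x : V, ω x ^ 2) = 1)
    (L m : ℝ) (hL : 0 ≤ L) (hm : 0 < m)
    (f : Fin k → V → ℝ) (T : Fin k → Finset V) (hTB : ∀ i, T i ⊆ B)
    (hTm : ∀ i, m ≤ (T i).card)
    (h1 : ∀ i, ∀ x ∈ T i, 1 ≤ f i x)
    (hdisj : ∀ i j x, f i x ≠ 0 → f j x ≠ 0 → i = j)
    (hlip : ∀ i u v, G.Adj u v → (f i u - f i v) ^ 2 ≤ L * (ω u ^ 2 + ω v ^ 2)) :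
    steklov G B k ≤ ENNReal.ofReal (2 * L * G.maxDegree / m) := by
  have hval : ∀ (a : Fin k → ℝ) (i : Fin k) (x : V), x ∈ T i →
      (∑ j, a j • f j) x = a i * f i x := by
    intro a i x hx
    have hne : f i x ≠ 0 := by linarith [h1 i x hx]
    rw [Finset.sum_apply, Finset.sum_eq_single i]
    · simp
    · intro j _ hj
      by_contra hcon
      apply hj
      apply hdisj j i x _ hne
      intro h0; apply hcon; simp [h0]
    · simp
  have hden : ∀ a : Fin k → ℝ, m * ∑ i, a i ^ 2 ≤ ∑ x ∈ B, (∑ j, a j • f j) x ^ 2 := by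
    intro a
    have hTd : ∀ i ∈ (univ : Finset (Fin k)), ∀ j ∈ (univ : Finset (Fin k)), i ≠ j →
        Disjoint (T i) (T j) := by
      intro i _ j _ hij
      rw [Finset.disjoint_left]
      intro x hx hy
      exact hij (hdisj i j x (by linarith [h1 i x hx]) (by linarith [h1 j x hy]))
    calc m * ∑ i, a i ^ 2 = ∑ i, m * a i ^ 2 := Finset.mul_sum _ _ _
      _ ≤ ∑ i, ∑ x ∈ T i, (∑ j, a j • f j) x ^ 2 := by
          apply Finset.sum_le_sum
          intro i _
          calc m * a i ^ 2 ≤ (T i).card * a i ^ 2 :=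
                mul_le_mul_of_nonneg_right (hTm i) (sq_nonneg _)
            _ = ∑ x ∈ T i, a i ^ 2 := by simp
            _ ≤ _ := by
              apply Finset.sum_le_sum
              intro x hx
              rw [hval a i x hx, mul_pow]
              have := h1 i x hx
              have : 1 ≤ f i x ^ 2 := by nlinarith
              nlinarith [sq_nonneg (a i)]
      _ = ∑ x ∈ univ.biUnion T, (∑ j, a j • f j) x ^ 2 := (Finset.sum_biUnion (fun i hi j hj hij => hTd i (by simp) j (by simp) hij)).symm
      _ ≤ _ := by
          apply Finset.sum_le_sum_of_subset_of_nonneg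
          · exact Finset.biUnion_subset.2 fun i _ => hTB i
          · intros; positivity
  have hen : ∀ a : Fin k → ℝ, energy G (∑ j, a j • f j) ≤
      2 * L * (∑ i, a i ^ 2) * G.maxDegree := by
    intro a
    have hs : 0 ≤ ∑ i, a i ^ 2 := Finset.sum_nonneg fun i _ => sq_nonneg _
    have := aux_edge_sum G ω (2 * L * ∑ i, a i ^ 2) (by positivity) (∑ j, a j • f j) ?_
    · rw [hnorm, mul_one] at this; exact this
    · intro u v huv
      simp only [Finset.sum_apply, Pi.smul_apply, smul_eq_mul]
      refine (aux_two a (fun i => f i u) (fun i => f i v) (fun i j => hdisj i j u)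
        (fun i j => hdisj i j v)).trans ?_
      have : ∑ i, a i ^ 2 * (f i u - f i v) ^ 2 ≤ ∑ i, a i ^ 2 * (L * (ω u ^ 2 + ω v ^ 2)) :=
        Finset.sum_le_sum fun i _ => mul_le_mul_of_nonneg_left (hlip i u v huv) (sq_nonneg _)
      rw [← Finset.sum_mul] at this
      linarith
  have hli : LinearIndependent ℝ f := by
    rw [Fintype.linearIndependent_iff]
    intro a ha i
    have := hden a
    rw [ha] at this
    simp at this
    have h0 : ∑ i, a i ^ 2 ≤ 0 := by nlinarith
    have h2 : a i ^ 2 ≤ ∑ i, a i ^ 2 :=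
      Finset.single_le_sum (f := fun i => a i ^ 2) (fun i _ => sq_nonneg _) (Finset.mem_univ i)
    nlinarith
  unfold steklov
  refine iInf₂_le_of_le (Submodule.span ℝ (Set.range f)) ?_ ?_
  · rw [finrank_span_eq_card hli, Fintype.card_fin]
  · apply iSup₂_le
    rintro g ⟨hg, hg0⟩
    obtain ⟨a, rfl⟩ := (Submodule.mem_span_range_iff_exists_fun ℝ).1 hg
    have hapos : 0 < ∑ i, a i ^ 2 := by
      rcases (Finset.sum_nonneg fun i _ => sq_nonneg (a i) :
        0 ≤ ∑ i, a i ^ 2).lt_or_eq with h | h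
      · exact h
      · exfalso; apply hg0
        have := (Finset.sum_eq_zero_iff_of_nonneg (fun i _ => sq_nonneg (a i))).1 h.symm
        apply Finset.sum_eq_zero
        intro i hi
        have := this i hi
        simp at this
        simp [this]
    have hd := hden a
    have hdpos : 0 < ∑ x ∈ B, (∑ j, a j • f j) x ^ 2 := lt_of_lt_of_le (by positivity) hd
    unfold rayleigh
    rw [if_neg]
    · apply ENNReal.ofReal_le_ofReal
      rw [div_le_div_iff₀ hdpos hm]
      calc energy G (∑ j, a j • f j) * m ≤ (2 * L * (∑ i, a i ^ 2) * G.maxDegree) * m :=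
            mul_le_mul_of_nonneg_right (hen a) hm.le
        _ = (2 * L * G.maxDegree) * (m * ∑ i, a i ^ 2) := by ring
        _ ≤ _ := mul_le_mul_of_nonneg_left hd (by positivity)
    · intro hall
      rw [Finset.sum_eq_zero (fun x hx => by rw [hall x hx]; simp)] at hdpos
      exact lt_irrefl _ hdpos

end Helpers

/-- Key estimate: if `ω` is a unit-norm `(⌊δ|B|/4k⌋, ε, B)`-spreading weight and `(V, d_ω)`
admits an `(ε/2)`-bounded `(α, δ)`-padded random partition, then
`σ_k ≤ (64k/δ) (D/|B|) (α/ε)²`. -/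
theorem steklov_le_of_spreading_padded [Fintype V] [DecidableEq V]
    (G : SimpleGraph V) [DecidableRel G.Adj] (hG : G.Connected)
    (B : Finset V) (hB : IsBoundary G B)
    (D : ℕ) (hD : D = G.maxDegree)
    (δ : ℝ) (hδ0 : 0 < δ) (hδ1 : δ < 1)
    (k : ℕ) (hk2 : 2 ≤ k) (hk : (k : ℝ) ≤ δ * B.card / 4)
    (r : ℕ) (hr : r = ⌊δ * B.card / (4 * k)⌋₊)
    (ω : V → ℝ) (hω : ∀ x, 0 ≤ ω x) (hnorm : (∑ x : V, ω x ^ 2) = 1)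
    (ε : ℝ) (hε : 0 < ε) (hspread : Spreading G B ω r ε)
    (α : ℝ) (hα : 0 < α)
    (hpad : ∃ ν : (V → Finset V) → ℝ,
      IsPaddedRandomPartition (dOmega G ω) (ε / 2) α δ ν) :
    steklov G B k ≤
      ENNReal.ofReal (64 * k / δ * ((D : ℝ) / B.card) * (α / ε) ^ 2) := by
  classical
  obtain ⟨ν, hν0, hν1, hpart, hdiam, hpadd⟩ := hpad
  have hkR : (2 : ℝ) ≤ k := by exact_mod_cast hk2
  have hn : (2 : ℝ) ≤ B.card := by exact_mod_cast hB.1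
  set c : ℝ := ε / 2 / α with hcdef
  have hc : 0 < c := by positivity
  set m : ℝ := δ * B.card / (4 * k) with hmdef
  have hm1 : 1 ≤ m := by
    rw [hmdef, le_div_iff₀ (by positivity)]; linarith
  have hr1 : 1 ≤ r := by rw [hr]; exact Nat.one_le_floor_iff _ |>.2 hm1
  have hrm : (r : ℝ) ≤ m := by rw [hr]; exact Nat.floor_le (by linarith)
  -- a good partition
  obtain ⟨P, hP0, hPA⟩ : ∃ P, ν P ≠ 0 ∧ δ * B.card ≤
      ((B.filter (fun x => ∀ y, dOmega G ω x y ≤ c → y ∈ P x)).card : ℝ) := by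
    by_contra! hcon
    have h1 : ∑ x ∈ B, δ ≤ ∑ x ∈ B, ∑ P : V → Finset V,
        if ∀ y, dOmega G ω x y ≤ c → y ∈ P x then ν P else 0 :=
      Finset.sum_le_sum fun x _ => hpadd x
    rw [Finset.sum_comm] at h1
    have h2 : ∑ P : V → Finset V, ∑ x ∈ B,
        (if ∀ y, dOmega G ω x y ≤ c → y ∈ P x then ν P else 0) <
        ∑ P : V → Finset V, ν P * (δ * B.card) := by
      apply Finset.sum_lt_sum
      · intro P _
        rw [← Finset.sum_filter, Finset.sum_const, nsmul_eq_mul, mul_comm]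
        by_cases hP : ν P = 0
        · simp [hP]
        · exact mul_le_mul_of_nonneg_left (hcon P hP).le (hν0 P)
      · obtain ⟨P, -, hP⟩ := Finset.exists_ne_zero_of_sum_ne_zero
          (by rw [hν1]; exact one_ne_zero : ∑ P : V → Finset V, ν P ≠ 0)
        refine ⟨P, Finset.mem_univ _, ?_⟩
        rw [← Finset.sum_filter, Finset.sum_const, nsmul_eq_mul, mul_comm]
        exact mul_lt_mul_of_pos_left (hcon P hP) (lt_of_le_of_ne (hν0 P) (Ne.symm hP))
    rw [← Finset.sum_mul, hν1] at h2
    simp only [Finset.sum_const, nsmul_eq_mul] at h1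
    linarith
  obtain ⟨hPm, hPe⟩ := hpart P hP0
  have hPd := hdiam P hP0
  set A := B.filter (fun x => ∀ y, dOmega G ω x y ≤ c → y ∈ P x) with hA
  have hAB : A ⊆ B := Finset.filter_subset _ _
  have hsmall : ∀ S : Finset V, ((A.filter (fun x => P x = S)).card : ℝ) ≤ m := by
    intro S
    refine le_trans ?_ hrm
    by_contra! hcon
    have hcard : r ≤ (A.filter (fun x => P x = S)).card := by exact_mod_cast hcon.le
    obtain ⟨S', hS', hcS'⟩ := Finset.exists_subset_card_eq hcard
    have hSp := hspread S' (hS'.trans ((Finset.filter_subset _ _).trans hAB)) hcS'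
    rw [hnorm, Real.sqrt_one, mul_one, hcS'] at hSp
    have hmem : ∀ u ∈ S', P u = S := fun u hu => (Finset.mem_filter.1 (hS' hu)).2
    have hsum : ∑ u ∈ S', ∑ v ∈ S', dOmega G ω u v ≤ ∑ u ∈ S', ∑ v ∈ S', ε / 2 := by
      apply Finset.sum_le_sum; intro u hu
      apply Finset.sum_le_sum; intro v hv
      refine hPd u u v (hPm u) ?_
      rw [hmem u hu, ← hmem v hv]; exact hPm v
    simp only [Finset.sum_const, nsmul_eq_mul, hcS'] at hsum
    have hrpos : (0 : ℝ) < r := by exact_mod_cast hr1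
    have : 1 / (r : ℝ) ^ 2 * ∑ u ∈ S', ∑ v ∈ S', dOmega G ω u v ≤
        1 / (r : ℝ) ^ 2 * (r * (r * (ε / 2))) := mul_le_mul_of_nonneg_left hsum (by positivity)
    have h2 : 1 / (r : ℝ) ^ 2 * (r * (r * (ε / 2))) = ε / 2 := by field_simp
    linarith
  obtain ⟨T, -, hT2, hT3⟩ := aux_group
    (fun S : Finset V => ((A.filter (fun x => P x = S)).card : ℝ)) m (by linarith) k univ
    (fun S _ => hsmall S) (by
      have h1 : ∑ S : Finset V, ((A.filter (fun x => P x = S)).card : ℝ) = A.card := by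
        have := Finset.card_eq_sum_card_fiberwise (f := P) (s := A) (t := univ)
          (fun x _ => by simp)
        exact_mod_cast this.symm
      rw [h1]
      have h2 : 2 * k * m = δ * B.card / 2 := by rw [hmdef]; field_simp; norm_num
      rw [h2]
      have : 0 ≤ δ * B.card := by positivity
      linarith)
  let Q : Fin k → Finset V := fun i => A.filter (fun x => P x ∈ T i)
  have hQm : ∀ i, m ≤ (Q i).card := by
    intro i
    refine (hT2 i).trans (le_of_eq ?_)
    have := Finset.card_eq_sum_card_fiberwise (f := P) (s := Q i) (t := T i)
      (fun x hx => (Finset.mem_filter.1 hx).2)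
    rw [this]
    push_cast
    apply Finset.sum_congr rfl
    intro S hS
    congr 2
    ext x
    simp only [Q, Finset.mem_filter]
    constructor
    · rintro ⟨h1, rfl⟩; exact ⟨⟨h1, hS⟩, rfl⟩
    · rintro ⟨⟨h1, -⟩, h2⟩; exact ⟨h1, h2⟩
  have hQne : ∀ i, (Q i).Nonempty := by
    intro i
    rw [← Finset.card_pos]
    have : (0 : ℝ) < (Q i).card := by linarith [hQm i]
    exact_mod_cast this
  have hsupp : ∀ i x, bump G ω c (Q i) (hQne i) x ≠ 0 → P x ∈ T i := by
    intro i x hx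
    obtain ⟨y, hy, hxy⟩ := aux_bump_supp G ω c hc (Q i) (hQne i) hx
    obtain ⟨hyA, hyT⟩ := Finset.mem_filter.1 hy
    rcases hxy with rfl | hxy
    · exact hyT
    · rw [hPe y x ((Finset.mem_filter.1 hyA).2 x hxy)]; exact hyT
  have hfin := aux_steklov G B k ω hnorm (2 / c ^ 2) m (by positivity) (by linarith)
    (fun i => bump G ω c (Q i) (hQne i)) Q (fun i => (Finset.filter_subset _ _).trans hAB) hQm
    (fun i x hx => aux_bump_one G ω c (Q i) (hQne i) hx)
    (fun i j x hi hj => hT3 i j (P x) (hsupp i x hi) (hsupp j x hj))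
    (fun i u v huv => (aux_bump_sq G hG ω hω c hc (Q i) (hQne i) huv).trans
      (le_of_eq (by ring)))
  refine hfin.trans (le_of_eq ?_)
  congr 1
  rw [← hD, hmdef, hcdef]
  field_simp
  ring
end

section
/- Let A_1, …, A_m be pairwise disjoint nonempty finite sets, let k ≥ 1 and s > 0, and suppose |A_i| ≤ s for every i and ∑_{i=1}^m |A_i| ≥ 4ks. Then there exist 2k pairwise disjoint sets S_1, …, S_{2k}, each of which is a union of some of the sets A_i, such that s ≤ |S_j| ≤ 2s for every 1 ≤ j ≤ 2k. -/
open Finset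

lemma grp_one {ι : Type*} [DecidableEq ι] (w : ι → ℝ) (s : ℝ) (hs : 0 < s)
    (hw : ∀ i, w i ≤ s) (T : Finset ι) (hT : s ≤ ∑ i ∈ T, w i) :
    ∃ I ⊆ T, s ≤ ∑ i ∈ I, w i ∧ ∑ i ∈ I, w i ≤ 2 * s := by
  induction T using Finset.induction_on with
  | empty => simp at hT; linarith
  | insert a T ha ih =>
    by_cases h : s ≤ ∑ i ∈ T, w i
    · obtain ⟨I, hI, h1⟩ := ih h
      exact ⟨I, hI.trans (Finset.subset_insert _ _), h1⟩
    · refine ⟨_, Finset.Subset.refl _, hT, ?_⟩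
      rw [Finset.sum_insert ha]
      have := hw a
      linarith

lemma grp_many {ι : Type*} [DecidableEq ι] (w : ι → ℝ) (s : ℝ) (hs : 0 < s)
    (hw : ∀ i, w i ≤ s) (n : ℕ) : ∀ (T : Finset ι), 2 * n * s ≤ ∑ i ∈ T, w i →
    ∃ I : Fin n → Finset ι, (∀ j, I j ⊆ T) ∧ (∀ j j', j ≠ j' → Disjoint (I j) (I j')) ∧
      ∀ j, s ≤ ∑ i ∈ I j, w i ∧ ∑ i ∈ I j, w i ≤ 2 * s := by
  induction n with
  | zero => exact fun T _ => ⟨fun _ => ∅, fun j => j.elim0, fun j => j.elim0, fun j => j.elim0⟩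
  | succ n ih =>
    intro T hT
    push_cast at hT
    have hns : 0 ≤ (n : ℝ) * s := by positivity
    obtain ⟨I0, h0, h1, h2⟩ := grp_one w s hs hw T (by nlinarith)
    have hsd := Finset.sum_sdiff (f := w) h0
    obtain ⟨I, hI, hd, hb⟩ := ih (T \ I0) (by nlinarith)
    have hdis : ∀ j, Disjoint I0 (I j) := fun j =>
      Finset.disjoint_of_subset_right (hI j) Finset.disjoint_sdiff
    refine ⟨Fin.cons I0 I, ?_, ?_, ?_⟩
    · intro j
      refine Fin.cases ?_ (fun j => ?_) j
      · simpa using h0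
      · simpa using (hI j).trans Finset.sdiff_subset
    · intro j j'
      refine Fin.cases ?_ (fun j => ?_) j <;> refine Fin.cases ?_ (fun j' => ?_) j'
      · simp
      · intro _; simpa using hdis j'
      · intro _; simpa using (hdis j).symm
      · intro h; simpa using hd j j' (fun e => h (by rw [e]))
    · intro j
      refine Fin.cases ?_ (fun j => ?_) j
      · simpa using ⟨h1, h2⟩
      · simpa using hb j

/-- Given pairwise disjoint nonempty finite sets `A_1, …, A_m` with `|A_i| ≤ s` and
`∑ |A_i| ≥ 4ks`, one can group them into `2k` pairwise disjoint unions `S_1, …, S_{2k}`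
with `s ≤ |S_j| ≤ 2s` for every `j`. -/
theorem exists_grouping {X : Type*} [DecidableEq X] (m k : ℕ) (hk : 1 ≤ k)
    (s : ℝ) (hs : 0 < s)
    (A : Fin m → Finset X)
    (hdisj : ∀ i j, i ≠ j → Disjoint (A i) (A j))
    (hne : ∀ i, (A i).Nonempty)
    (hcard : ∀ i, ((A i).card : ℝ) ≤ s)
    (htot : 4 * k * s ≤ ∑ i : Fin m, ((A i).card : ℝ)) :
    ∃ S : Fin (2 * k) → Finset X,
      (∀ j j', j ≠ j' → Disjoint (S j) (S j')) ∧
      (∀ j, ∃ I : Finset (Fin m), S j = I.biUnion A) ∧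
      (∀ j, s ≤ ((S j).card : ℝ) ∧ ((S j).card : ℝ) ≤ 2 * s) := by
  obtain ⟨I, -, hd, hb⟩ := grp_many (fun i => ((A i).card : ℝ)) s hs hcard (2 * k) Finset.univ
    (by push_cast; linarith)
  refine ⟨fun j => (I j).biUnion A, ?_, fun j => ⟨I j, rfl⟩, ?_⟩
  · intro j j' h
    rw [Finset.disjoint_biUnion_left]
    intro a ha
    rw [Finset.disjoint_biUnion_right]
    intro b hb'
    exact hdisj a b (fun e => Finset.disjoint_left.mp (hd j j' h) ha (e ▸ hb'))
  · intro j
    have : (((I j).biUnion A).card : ℝ) = ∑ i ∈ I j, ((A i).card : ℝ) := by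
      rw [Finset.card_biUnion (fun a _ b _ h => hdisj a b h)]
      push_cast
      rfl
    simpa only [this] using hb j
end

section
/- Let G = (V, E) be a finite simple connected graph with boundary B and let 2 ≤ r ≤ |B|. Then max{ε_r(G, B, ω) : ω : V → ℝ_{≥0}} = (1/r²) · min{√(con(F)) : F ∈ ℱ_r(G, B)}. -/
open Finset
open scoped ENNReal

variable {V : Type*}

/-- The index type of all paths in `G`: a path together with its endpoints. -/
abbrev PathIdx (G : SimpleGraph V) := Σ u : V, Σ v : V, G.Path u v

/-- The amount of flow `F[u,v]` sent between `u` and `v`: the total flow over paths in `𝒫_{uv}`. -/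
noncomputable def flowAmt [Fintype V] [DecidableEq V] (G : SimpleGraph V) [DecidableRel G.Adj]
    (F : PathIdx G → ℝ) (u v : V) : ℝ :=
  ∑ p : G.Path u v, F ⟨u, v, p⟩

/-- The congestion at a vertex: `C_F(v) = ∑_{p ∈ 𝒫 : v ∈ p} F(p)`. -/
noncomputable def vertexCongestion [Fintype V] [DecidableEq V] (G : SimpleGraph V)
    [DecidableRel G.Adj] (F : PathIdx G → ℝ) (x : V) : ℝ :=
  ∑ q : PathIdx G, if x ∈ (q.2.2 : G.Walk q.1 q.2.1).support then F q else 0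

/-- The congestion of a flow: `con(F) = ∑_{v ∈ V} C_F(v)²`. -/
noncomputable def con [Fintype V] [DecidableEq V] (G : SimpleGraph V) [DecidableRel G.Adj]
    (F : PathIdx G → ℝ) : ℝ :=
  ∑ x : V, (vertexCongestion G F x) ^ 2

/-- The intersection number of a flow:
`inter(F) = ∑_{u,v,u',v' distinct} ∑_{p ∈ 𝒫_{uv}, p' ∈ 𝒫_{u'v'}} ∑_{x ∈ p ∩ p'} F(p) F(p')`. -/
noncomputable def inter [Fintype V] [DecidableEq V] (G : SimpleGraph V) [DecidableRel G.Adj]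
    (F : PathIdx G → ℝ) : ℝ :=
  ∑ q : PathIdx G, ∑ q' : PathIdx G,
    if ({q.1, q.2.1, q'.1, q'.2.1} : Finset V).card = 4 then
      (((q.2.2 : G.Walk q.1 q.2.1).support.toFinset ∩
          (q'.2.2 : G.Walk q'.1 q'.2.1).support.toFinset).card : ℝ) * F q * F q'
    else 0

/-- `F` is a `μ`-flow for the probability distribution `μ` on subsets of `V`:
`F[u,v] = ℙ_{S∼μ}[u,v ∈ S]` for all `u, v`. -/
def IsMuFlow [Fintype V] [DecidableEq V] (G : SimpleGraph V) [DecidableRel G.Adj]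
    (F : PathIdx G → ℝ) (μ : Finset V → ℝ) : Prop :=
  ∀ u v : V, flowAmt G F u v = ∑ S ∈ univ.filter (fun S : Finset V => u ∈ S ∧ v ∈ S), μ S

/-- `F ∈ ℱ_r(G, B)`: `F` is a nonnegative `μ`-flow for some probability distribution `μ`
supported on `r`-element subsets of `B`. -/
def MemFlows [Fintype V] [DecidableEq V] (G : SimpleGraph V) [DecidableRel G.Adj]
    (B : Finset V) (r : ℕ) (F : PathIdx G → ℝ) : Prop :=
  (∀ q, 0 ≤ F q) ∧
    ∃ μ : Finset V → ℝ, (∀ S, 0 ≤ μ S) ∧ (∑ S : Finset V, μ S) = 1 ∧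
      (∀ S, μ S ≠ 0 → S ⊆ B ∧ S.card = r) ∧ IsMuFlow G F μ

section helpers
variable [Fintype V] [DecidableEq V] (G : SimpleGraph V) [DecidableRel G.Adj]

noncomputable def wlen (ω : V → ℝ) (q : PathIdx G) : ℝ :=
  ((q.2.2 : G.Walk q.1 q.2.1).support.map ω).sum

theorem sum_omega_cong (ω : V → ℝ) (F : PathIdx G → ℝ) :
    ∑ x, ω x * vertexCongestion G F x = ∑ q, F q * wlen G ω q := by
  simp only [vertexCongestion, Finset.mul_sum]
  rw [Finset.sum_comm]
  refine Finset.sum_congr rfl fun q _ => ?_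
  have h : wlen G ω q = ∑ x ∈ (q.2.2 : G.Walk q.1 q.2.1).support.toFinset, ω x := by
    rw [List.sum_toFinset _ q.2.2.2.support_nodup]; rfl
  rw [h, Finset.mul_sum]
  simp only [mul_ite, mul_zero]
  rw [← Finset.sum_filter]
  refine Finset.sum_congr ?_ fun x _ => mul_comm _ _
  ext x; simp

theorem dOmega_set_finite (ω : V → ℝ) (u v : V) :
    {s | ∃ p : G.Walk u v, p.IsPath ∧ s = (p.support.map ω).sum}.Finite := by
  refine (Set.finite_range (fun p : G.Path u v => ((p : G.Walk u v).support.map ω).sum)).subset ?_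
  rintro s ⟨p, hp, rfl⟩
  exact ⟨⟨p, hp⟩, rfl⟩

theorem dOmega_le (ω : V → ℝ) (q : PathIdx G) : dOmega G ω q.1 q.2.1 ≤ wlen G ω q :=
  csInf_le (dOmega_set_finite G ω _ _).bddBelow ⟨q.2.2.1, q.2.2.2, rfl⟩

theorem dOmega_attained (hG : G.Connected) (ω : V → ℝ) (u v : V) :
    ∃ p : G.Path u v, wlen G ω ⟨u, v, p⟩ = dOmega G ω u v := by
  have hne : {s | ∃ p : G.Walk u v, p.IsPath ∧ s = (p.support.map ω).sum}.Nonempty := by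
    obtain ⟨p, hp⟩ := (hG.preconnected u v).exists_isPath
    exact ⟨_, p, hp, rfl⟩
  obtain ⟨p, hp, h⟩ := hne.csInf_mem (dOmega_set_finite G ω u v)
  exact ⟨⟨p, hp⟩, h.symm⟩

theorem sum_flow_d (F : PathIdx G → ℝ) (μ : Finset V → ℝ) (h : IsMuFlow G F μ)
    (d : V → V → ℝ) :
    ∑ q : PathIdx G, F q * d q.1 q.2.1 = ∑ S, μ S * ∑ u ∈ S, ∑ v ∈ S, d u v := by
  rw [Fintype.sum_sigma]
  simp only [Fintype.sum_sigma]
  have h1 : ∀ u v, ∑ p : G.Path u v, F ⟨u, v, p⟩ * d u v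
      = ∑ S, if u ∈ S ∧ v ∈ S then μ S * d u v else 0 := by
    intro u v
    rw [← Finset.sum_mul]
    have := h u v
    unfold flowAmt at this
    rw [this, Finset.sum_mul, Finset.sum_filter]
  simp only [h1]
  have h2 : ∀ S : Finset V, μ S * ∑ u ∈ S, ∑ v ∈ S, d u v
      = ∑ u, ∑ v, if u ∈ S ∧ v ∈ S then μ S * d u v else 0 := by
    intro S
    simp only [ite_and, Finset.mul_sum]
    rw [← Finset.sum_subset (Finset.subset_univ S)]
    · exact Finset.sum_congr rfl fun u hu => by simp [hu]
    · intro u _ hu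
      simp [hu]
  simp only [h2]
  conv_rhs => rw [Finset.sum_comm]
  refine Finset.sum_congr rfl fun u _ => ?_
  rw [Finset.sum_comm]

theorem routed (hG : G.Connected) (ω : V → ℝ) (B S : Finset V) (r : ℕ) (hS : S ⊆ B)
    (hc : S.card = r) : ∃ F, MemFlows G B r F ∧
      ∑ x, ω x * vertexCongestion G F x = ∑ u ∈ S, ∑ v ∈ S, dOmega G ω u v := by
  classical
  choose π hπ using dOmega_attained G hG ω
  let F : PathIdx G → ℝ := fun q => if q.1 ∈ S ∧ q.2.1 ∈ S ∧ q.2.2 = π q.1 q.2.1 then 1 else 0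
  let μ : Finset V → ℝ := fun T => if T = S then 1 else 0
  have hF : IsMuFlow G F μ := by
    intro u v
    simp only [flowAmt, F, μ]
    by_cases hu : u ∈ S <;> by_cases hv : v ∈ S <;> simp [hu, hv, Finset.sum_ite_eq']
  refine ⟨F, ⟨fun q => ?_, μ, fun T => ?_, ?_, ?_, hF⟩, ?_⟩
  · simp only [F]; split_ifs <;> norm_num
  · simp only [μ]; split_ifs <;> norm_num
  · simp [μ]
  · intro T hT
    have : T = S := by by_contra h; simp [μ, h] at hT
    subst this; exact ⟨hS, hc⟩
  · rw [sum_omega_cong]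
    have : ∀ q, F q * wlen G ω q = F q * dOmega G ω q.1 q.2.1 := by
      rintro ⟨u, v, p⟩
      simp only [F]
      split_ifs with h
      · obtain ⟨_, _, rfl⟩ := h
        rw [hπ]
      · simp
    rw [Finset.sum_congr rfl fun q _ => this q, sum_flow_d G F μ hF]
    simp [μ]

def pairSet (B : Finset V) (r : ℕ) : Set ((PathIdx G → ℝ) × (Finset V → ℝ)) :=
  {x | (∀ q, 0 ≤ x.1 q) ∧ (∀ S, 0 ≤ x.2 S) ∧ (∑ S : Finset V, x.2 S) = 1 ∧
      (∀ S, ¬ (S ⊆ B ∧ S.card = r) → x.2 S = 0) ∧ IsMuFlow G x.1 x.2}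

theorem pairSet_compact (B : Finset V) (r : ℕ) : IsCompact (pairSet G B r) := by
  have hcl : IsClosed (pairSet G B r) := by
    unfold pairSet IsMuFlow flowAmt
    simp only [Set.ofPred_and, Set.ofPred_forall]
    refine IsClosed.inter ?_ (IsClosed.inter ?_ (IsClosed.inter ?_ (IsClosed.inter ?_ ?_)))
    · exact isClosed_iInter fun q => isClosed_le (by fun_prop) (by fun_prop)
    · exact isClosed_iInter fun q => isClosed_le (by fun_prop) (by fun_prop)
    · exact isClosed_eq (by fun_prop) (by fun_prop)
    · exact isClosed_iInter fun q => isClosed_iInter fun _ => isClosed_eq (by fun_prop) (by fun_prop)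
    · exact isClosed_iInter fun q => isClosed_iInter fun _ => isClosed_eq (by fun_prop) (by fun_prop)
  refine IsCompact.of_isClosed_subset (isCompact_Icc (a := (0, 0)) (b := (1, 1))) hcl ?_
  rintro ⟨F, μ⟩ ⟨h1, h2, h3, h4, h5⟩
  refine ⟨⟨h1, h2⟩, ⟨fun q => ?_, fun S => ?_⟩⟩
  · obtain ⟨u, v, p⟩ := q
    calc F ⟨u, v, p⟩ ≤ flowAmt G F u v :=
          Finset.single_le_sum (f := fun p => F ⟨u, v, p⟩) (fun p _ => h1 _) (Finset.mem_univ p)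
      _ = _ := h5 u v
      _ ≤ ∑ S, μ S := Finset.sum_le_sum_of_subset_of_nonneg (Finset.filter_subset _ _)
          (fun S _ _ => h2 S)
      _ = 1 := h3
  · calc μ S ≤ ∑ S, μ S := Finset.single_le_sum (fun S _ => h2 S) (Finset.mem_univ S)
      _ = 1 := h3

theorem memFlows_iff (B : Finset V) (r : ℕ) (F) :
    MemFlows G B r F ↔ ∃ μ, (F, μ) ∈ pairSet G B r := by
  constructor
  · rintro ⟨h1, μ, h2, h3, h4, h5⟩
    exact ⟨μ, h1, h2, h3, fun S hS => by by_contra h; exact hS (h4 S h), h5⟩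
  · rintro ⟨μ, h1, h2, h3, h4, h5⟩
    exact ⟨h1, μ, h2, h3, fun S hS => by by_contra h; exact hS (h4 S h), h5⟩

theorem memFlows_convex (B : Finset V) (r : ℕ) (F F' : PathIdx G → ℝ) (hF : MemFlows G B r F)
    (hF' : MemFlows G B r F') (t : ℝ) (h0 : 0 ≤ t) (ht : t ≤ 1) :
    MemFlows G B r (fun q => (1 - t) * F q + t * F' q) := by
  rw [memFlows_iff] at *
  obtain ⟨μ, h1, h2, h3, h4, h5⟩ := hF
  obtain ⟨ν, k1, k2, k3, k4, k5⟩ := hF'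
  have ht' : 0 ≤ 1 - t := by linarith
  refine ⟨fun S => (1 - t) * μ S + t * ν S, fun q => ?_, fun S => ?_, ?_, fun S hS => ?_, ?_⟩
  · exact add_nonneg (mul_nonneg ht' (h1 q)) (mul_nonneg h0 (k1 q))
  · exact add_nonneg (mul_nonneg ht' (h2 S)) (mul_nonneg h0 (k2 S))
  · simp only at h3 k3 ⊢
    rw [Finset.sum_add_distrib, ← Finset.mul_sum, ← Finset.mul_sum, h3, k3]; ring
  · have a := h4 S hS
    have b := k4 S hS
    simp only at a b ⊢
    rw [a, b]; ring
  · intro u v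
    have a := h5 u v
    have b := k5 u v
    simp only [flowAmt] at a b ⊢
    rw [Finset.sum_add_distrib, ← Finset.mul_sum, ← Finset.mul_sum, a, b,
      Finset.sum_add_distrib, ← Finset.mul_sum, ← Finset.mul_sum]

theorem cong_comb (F F' : PathIdx G → ℝ) (t : ℝ) (x : V) :
    vertexCongestion G (fun q => (1 - t) * F q + t * F' q) x
      = vertexCongestion G F x + t * (vertexCongestion G F' x - vertexCongestion G F x) := by
  simp only [vertexCongestion, ← Finset.sum_sub_distrib, Finset.mul_sum, ← Finset.sum_add_distrib]
  refine Finset.sum_congr rfl fun q _ => ?_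
  split_ifs <;> ring

theorem con_cont : Continuous (con G) := by
  have hc : ∀ x, Continuous fun F => vertexCongestion G F x := by
    intro x
    unfold vertexCongestion
    refine continuous_finsetSum _ fun q _ => ?_
    by_cases h : x ∈ (q.2.2 : G.Walk q.1 q.2.1).support
    · simp only [h, if_true]; exact continuous_apply q
    · simp only [h, if_false]; exact continuous_const
  unfold con
  exact continuous_finsetSum _ fun x _ => (hc x).pow 2

theorem exists_min (hG : G.Connected) (B : Finset V) (r : ℕ) (hrB : r ≤ B.card) :
    ∃ F, MemFlows G B r F ∧ ∀ F', MemFlows G B r F' → con G F ≤ con G F' := by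
  obtain ⟨S, hS, hc⟩ := Finset.exists_subset_card_eq hrB
  obtain ⟨F0, hF0, _⟩ := routed G hG 0 B S r hS hc
  obtain ⟨μ0, h0⟩ := (memFlows_iff G B r F0).1 hF0
  have hcont : Continuous fun x : (PathIdx G → ℝ) × (Finset V → ℝ) => con G x.1 :=
    (con_cont G).comp continuous_fst
  obtain ⟨⟨F, μ⟩, hm, hmin⟩ := (pairSet_compact G B r).exists_isMinOn ⟨_, h0⟩ hcont.continuousOn
  refine ⟨F, (memFlows_iff G B r F).2 ⟨μ, hm⟩, fun F' hF' => ?_⟩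
  obtain ⟨μ', h'⟩ := (memFlows_iff G B r F').1 hF'
  exact isMinOn_iff.1 hmin (F', μ') h'

theorem first_order (B : Finset V) (r : ℕ) (F) (hF : MemFlows G B r F)
    (hmin : ∀ F', MemFlows G B r F' → con G F ≤ con G F') (F') (hF' : MemFlows G B r F') :
    con G F ≤ ∑ x, vertexCongestion G F x * vertexCongestion G F' x := by
  set c := vertexCongestion G F
  set c' := vertexCongestion G F'
  set A := ∑ x, c x * (c' x - c x) with hA
  set Q := ∑ x, (c' x - c x) ^ 2 with hQ
  have key : ∀ t : ℝ, 0 ≤ t → t ≤ 1 → 0 ≤ 2 * t * A + t ^ 2 * Q := by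
    intro t h0 h1
    have h := hmin _ (memFlows_convex G B r F F' hF hF' t h0 h1)
    have e : con G (fun q => (1 - t) * F q + t * F' q) = con G F + (2 * t * A + t ^ 2 * Q) := by
      simp only [con, cong_comb, hA, hQ, Finset.mul_sum, ← Finset.sum_add_distrib]
      exact Finset.sum_congr rfl fun x _ => by ring
    linarith
  have hQ0 : 0 ≤ Q := Finset.sum_nonneg fun x _ => sq_nonneg _
  have hA0 : 0 ≤ A := by
    by_contra hneg
    push Not at hneg
    have hp : 0 < Q - A := by linarith
    have := key (-A / (Q - A)) (div_nonneg (by linarith) hp.le) ((div_le_one hp).2 (by linarith))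
    have e : 2 * (-A / (Q - A)) * A + (-A / (Q - A)) ^ 2 * Q
        = A ^ 2 * (2 * A - Q) / (Q - A) ^ 2 := by
      field_simp; ring
    rw [e] at this
    have : A ^ 2 * (2 * A - Q) / (Q - A) ^ 2 < 0 :=
      div_neg_of_neg_of_pos (mul_neg_of_pos_of_neg (sq_pos_of_neg hneg) (by linarith)) (by positivity)
    linarith
  have : A = (∑ x, c x * c' x) - con G F := by
    simp only [hA, con, ← Finset.sum_sub_distrib]
    exact Finset.sum_congr rfl fun x _ => by ring
  linarith

theorem weak_duality (B : Finset V) (r : ℕ) (hr : 0 < r) (ω : V → ℝ) (ε : ℝ)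
    (hs : Spreading G B ω r ε) (F) (hF : MemFlows G B r F) :
    (r : ℝ) ^ 2 * (ε * √(∑ x, ω x ^ 2)) ≤ √(∑ x, ω x ^ 2) * √(con G F) := by
  obtain ⟨h1, μ, h2, h3, h4, h5⟩ := hF
  have hr' : (0 : ℝ) < r := by exact_mod_cast hr
  calc (r : ℝ) ^ 2 * (ε * √(∑ x, ω x ^ 2))
      = ∑ S, μ S * ((r : ℝ) ^ 2 * (ε * √(∑ x, ω x ^ 2))) := by rw [← Finset.sum_mul, h3, one_mul]
    _ ≤ ∑ S, μ S * ∑ u ∈ S, ∑ v ∈ S, dOmega G ω u v := by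
        refine Finset.sum_le_sum fun S _ => ?_
        by_cases hS : μ S = 0
        · simp [hS]
        · obtain ⟨hB, hc⟩ := h4 S hS
          refine mul_le_mul_of_nonneg_left ?_ (h2 S)
          have := hs S hB hc
          rw [hc, one_div, inv_mul_eq_div, le_div_iff₀ (by positivity)] at this
          linarith
    _ = ∑ q, F q * dOmega G ω q.1 q.2.1 := (sum_flow_d G F μ h5 _).symm
    _ ≤ ∑ q, F q * wlen G ω q :=
        Finset.sum_le_sum fun q _ => mul_le_mul_of_nonneg_left (dOmega_le G ω q) (h1 q)
    _ = ∑ x, ω x * vertexCongestion G F x := (sum_omega_cong G ω F).symm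
    _ ≤ _ := Real.sum_mul_le_sqrt_mul_sqrt _ _ _

theorem cong_nonneg (F : PathIdx G → ℝ) (h : ∀ q, 0 ≤ F q) (x : V) :
    0 ≤ vertexCongestion G F x :=
  Finset.sum_nonneg fun q _ => by split_ifs <;> simp [h]

end helpers

/-- Duality: `max{ε_r(G,B,ω) : ω ≥ 0} = (1/r²) min{√(con F) : F ∈ ℱ_r(G,B)}`,
where the maximum and the minimum are attained. -/
theorem epsSpread_duality [Fintype V] [DecidableEq V]
    (G : SimpleGraph V) [DecidableRel G.Adj] (hG : G.Connected)
    (B : Finset V) (hB : IsBoundary G B)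
    (r : ℕ) (hr2 : 2 ≤ r) (hrB : r ≤ B.card) :
    ∃ E C : ℝ,
      IsGreatest {ε : ℝ | ∃ ω : V → ℝ, (∀ x, 0 ≤ ω x) ∧ ε = epsSpread G B ω r} E ∧
      IsLeast {c : ℝ | ∃ F : PathIdx G → ℝ, MemFlows G B r F ∧ c = Real.sqrt (con G F)} C ∧
      E = (1 / (r : ℝ) ^ 2) * C := by
  obtain ⟨F, hF, hmin⟩ := exists_min G hG B r hrB
  have hr' : (0 : ℝ) < r := by exact_mod_cast (by omega : 0 < r)
  have hub : ∀ ω : V → ℝ, 0 < √(∑ x, ω x ^ 2) → ∀ ε, Spreading G B ω r ε →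
      ε ≤ (1 / (r : ℝ) ^ 2) * √(con G F) := by
    intro ω hω ε hs
    have := weak_duality G B r (by omega) ω ε hs F hF
    rw [one_div, inv_mul_eq_div, le_div_iff₀ (by positivity)]
    refine le_of_mul_le_mul_left ?_ hω
    linarith
  have hz : ∀ ω : V → ℝ, √(∑ x, ω x ^ 2) = 0 → (∀ x, 0 ≤ ω x) → epsSpread G B ω r = 0 := by
    intro ω hω h0
    have : {ε | Spreading G B ω r ε} = Set.univ := by
      refine Set.eq_univ_of_forall fun ε S _ _ => ?_
      rw [hω, mul_zero]
      refine mul_nonneg (by positivity) (Finset.sum_nonneg fun u _ => Finset.sum_nonneg fun v _ => ?_)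
      refine Real.sInf_nonneg ?_
      rintro s ⟨p, hp, rfl⟩
      refine List.sum_nonneg ?_
      intro a ha
      obtain ⟨x, _, rfl⟩ := List.mem_map.1 ha
      exact h0 x
    rw [epsSpread, this, Real.sSup_univ]
  refine ⟨_, √(con G F), ⟨⟨vertexCongestion G F, cong_nonneg G F hF.1, ?_⟩, ?_⟩,
    ⟨⟨F, hF, rfl⟩, ?_⟩, rfl⟩
  · have hn : √(∑ x, vertexCongestion G F x ^ 2) = √(con G F) := rfl
    rcases (Real.sqrt_nonneg (con G F)).eq_or_lt with h | h
    · rw [hz _ (hn.trans h.symm) (cong_nonneg G F hF.1), ← h, mul_zero]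
    · refine (IsGreatest.csSup_eq ⟨?_, fun ε hε => hub _ h ε hε⟩).symm
      intro S hS hc
      rw [hn, hc, mul_assoc, Real.mul_self_sqrt (show 0 ≤ con G F from Finset.sum_nonneg fun x _ => sq_nonneg _)]
      refine mul_le_mul_of_nonneg_left ?_ (by positivity)
      obtain ⟨F', hF', e⟩ := routed G hG (vertexCongestion G F) B S r hS hc
      rw [← e]
      exact first_order G B r F hF hmin F' hF'
  · rintro _ ⟨ω, h0, rfl⟩
    rcases (Real.sqrt_nonneg (∑ x, ω x ^ 2)).eq_or_lt with h | h
    · rw [hz ω h.symm h0]; positivity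
    · exact Real.sSup_le (fun ε hε => hub ω h ε hε) (by positivity)
  · rintro _ ⟨F', hF', rfl⟩
    exact Real.sqrt_le_sqrt (hmin F' hF')
end

section
/- Let G = (V, E) be a finite simple connected graph with boundary B, let 2 ≤ r ≤ |B|, let ω : V → ℝ_{≥0} be any vertex weight, and let F ∈ ℱ_r(G, B) be any flow. Then ε_r(G, B, ω) ≤ (1/r²) √(con(F)). -/
open Finset
open scoped ENNReal

variable {V : Type*}

lemma dOmega_le_aux [Fintype V] [DecidableEq V] (G : SimpleGraph V)
    (ω : V → ℝ) (hω : ∀ x, 0 ≤ ω x) (u v : V) (p : G.Path u v) :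
    dOmega G ω u v ≤ ∑ x : V, if x ∈ (p : G.Walk u v).support then ω x else 0 := by
  have h1 : ((p : G.Walk u v).support.map ω).sum
      = ∑ x : V, if x ∈ (p : G.Walk u v).support then ω x else 0 := by
    rw [← List.sum_toFinset ω p.2.support_nodup, ← Finset.sum_filter]
    apply Finset.sum_congr _ (fun _ _ => rfl)
    ext x; simp
  rw [← h1]
  apply csInf_le
  · refine ⟨0, ?_⟩
    rintro s ⟨q, _, rfl⟩
    apply List.sum_nonneg
    intro a ha
    obtain ⟨x, _, rfl⟩ := List.mem_map.1 ha
    exact hω x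
  · exact ⟨p, p.2, rfl⟩

lemma flow_dist_le_aux [Fintype V] [DecidableEq V] (G : SimpleGraph V) [DecidableRel G.Adj]
    (ω : V → ℝ) (hω : ∀ x, 0 ≤ ω x) (F : PathIdx G → ℝ) (hF : ∀ q, 0 ≤ F q) :
    ∑ u : V, ∑ v : V, flowAmt G F u v * dOmega G ω u v ≤
      ∑ x : V, ω x * vertexCongestion G F x := by
  have e : ∑ x : V, ω x * vertexCongestion G F x = ∑ q : PathIdx G,
      F q * ∑ x : V, if x ∈ (q.2.2 : G.Walk q.1 q.2.1).support then ω x else 0 := by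
    simp only [vertexCongestion, Finset.mul_sum]
    rw [Finset.sum_comm]
    refine Finset.sum_congr rfl fun q _ => Finset.sum_congr rfl fun x _ => ?_
    split_ifs <;> ring
  rw [e, Fintype.sum_sigma]
  refine Finset.sum_le_sum fun u _ => ?_
  rw [Fintype.sum_sigma]
  refine Finset.sum_le_sum fun v _ => ?_
  rw [flowAmt, Finset.sum_mul]
  exact Finset.sum_le_sum fun p _ =>
    mul_le_mul_of_nonneg_left (dOmega_le_aux G ω hω u v p) (hF _)

lemma Finset.sum_filter_mem_eq_aux [Fintype V] [DecidableEq V] (S : Finset V) (f : V → ℝ) :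
    (∑ u : V, if u ∈ S then f u else 0) = ∑ u ∈ S, f u := by
  simp

/-- For any vertex weight `ω` and any flow `F ∈ ℱ_r(G, B)`,
`ε_r(G, B, ω) ≤ (1/r²) √(con(F))`. -/
theorem epsSpread_le_sqrt_con [Fintype V] [DecidableEq V]
    (G : SimpleGraph V) [DecidableRel G.Adj] (hG : G.Connected)
    (B : Finset V) (hB : IsBoundary G B)
    (r : ℕ) (hr2 : 2 ≤ r) (hrB : r ≤ B.card)
    (ω : V → ℝ) (hω : ∀ x, 0 ≤ ω x)
    (F : PathIdx G → ℝ) (hF : MemFlows G B r F) :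
    epsSpread G B ω r ≤ (1 / (r : ℝ) ^ 2) * Real.sqrt (con G F) := by
  obtain ⟨hF0, μ, hμ0, hμ1, hμs, hμF⟩ := hF
  have hr : (0 : ℝ) < (r : ℝ) ^ 2 := by
    have : (0 : ℝ) < r := by exact_mod_cast (by omega : 0 < r)
    positivity
  have hR : 0 ≤ (1 / (r : ℝ) ^ 2) * Real.sqrt (con G F) := by positivity
  unfold epsSpread
  set W := Real.sqrt (∑ x : V, ω x ^ 2) with hW
  rcases (Real.sqrt_nonneg (∑ x : V, ω x ^ 2)).eq_or_lt with h0 | hpos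
  · have hz : ∀ x, ω x = 0 := by
      intro x
      have h1 : ∑ x : V, ω x ^ 2 = 0 :=
        (Real.sqrt_eq_zero (Finset.sum_nonneg fun x _ => sq_nonneg _)).1 h0.symm
      have h2 := (Finset.sum_eq_zero_iff_of_nonneg (fun x _ => sq_nonneg (ω x))).1 h1 x
        (Finset.mem_univ x)
      exact pow_eq_zero_iff (two_ne_zero) |>.1 h2
    have hd : ∀ u v, 0 ≤ dOmega G ω u v := by
      intro u v
      apply Real.sInf_nonneg
      rintro s ⟨q, _, rfl⟩
      apply List.sum_nonneg
      intro a ha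
      obtain ⟨x, _, rfl⟩ := List.mem_map.1 ha
      exact hω x
    have huniv : {ε | Spreading G B ω r ε} = Set.univ := by
      ext ε
      simp only [Set.mem_ofPred_eq, Set.mem_univ, iff_true]
      intro S _ _
      rw [← h0, mul_zero]
      exact mul_nonneg (div_nonneg zero_le_one (sq_nonneg _))
        (Finset.sum_nonneg fun u _ => Finset.sum_nonneg fun v _ => hd u v)
    rw [huniv, Real.sSup_univ]
    exact hR
  · apply Real.sSup_le _ hR
    intro ε hε
    have key : ε * W * (r : ℝ) ^ 2 ≤ ∑ u : V, ∑ v : V, flowAmt G F u v * dOmega G ω u v := by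
      have e : ∑ u : V, ∑ v : V, flowAmt G F u v * dOmega G ω u v
          = ∑ S : Finset V, μ S * ∑ u ∈ S, ∑ v ∈ S, dOmega G ω u v := by
        have e1 : ∀ S : Finset V, μ S * ∑ u ∈ S, ∑ v ∈ S, dOmega G ω u v
            = ∑ u : V, ∑ v : V, if u ∈ S ∧ v ∈ S then μ S * dOmega G ω u v else 0 := by
          intro S
          rw [Finset.mul_sum, ← Finset.sum_filter_mem_eq_aux S]
          refine Finset.sum_congr rfl fun u _ => ?_
          by_cases hu : u ∈ S
          · simp [hu, Finset.mul_sum]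
          · simp [hu]
        simp only [e1]
        symm
        rw [Finset.sum_comm]
        refine Finset.sum_congr rfl fun u _ => ?_
        rw [Finset.sum_comm]
        refine Finset.sum_congr rfl fun v _ => ?_
        rw [hμF u v, Finset.sum_mul, Finset.sum_filter]
      rw [e]
      calc ε * W * (r : ℝ) ^ 2 = ∑ S : Finset V, μ S * (ε * W * (r : ℝ) ^ 2) := by
            rw [← Finset.sum_mul, hμ1, one_mul]
        _ ≤ _ := by
            refine Finset.sum_le_sum fun S _ => ?_
            by_cases hS : μ S = 0
            · simp [hS]
            · obtain ⟨hSB, hSr⟩ := hμs S hS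
              have := hε S hSB hSr
              rw [hSr, one_div, ← div_eq_inv_mul, le_div_iff₀ hr] at this
              exact mul_le_mul_of_nonneg_left this (hμ0 S)
    have hCS : ∑ x : V, ω x * vertexCongestion G F x ≤ W * Real.sqrt (con G F) :=
      Real.sum_mul_le_sqrt_mul_sqrt _ _ _
    have h3 := (key.trans (flow_dist_le_aux G ω hω F hF0)).trans hCS
    rw [one_div, ← div_eq_inv_mul, le_div_iff₀ hr]
    refine le_of_mul_le_mul_left ?_ hpos
    rw [← hW]
    linarith
end

section
/- Let G = (V, E) be a finite simple connected graph with boundary B, let 2 ≤ r ≤ |B|, and let F ∈ ℱ_r(G, B) be a μ-flow for a probability distribution μ supported on r-element subsets of B. Let H_μ be the edge-weighted complete graph on vertex set B with edge weights w(u, v) = ℙ_{S∼μ}[u, v ∈ S]. Then inter_G(H_μ) ≤ con(F). -/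
open Finset
open scoped ENNReal

variable {V : Type*}

/-- `F'` is an `H_μ`-flow in `G`, where `H_μ` is the edge-weighted complete graph on the
vertex set `B` with edge weights `w(u,v) = ℙ_{S∼μ}[u,v ∈ S]`: `F'` is nonnegative and there is
an injective map `φ : B → V` with `F'[φ(u), φ(v)] ≥ w(u,v)` for every edge `{u,v}` of `H_μ`. -/
def IsHMuFlow [Fintype V] [DecidableEq V] (G : SimpleGraph V) [DecidableRel G.Adj]
    (B : Finset V) (μ : Finset V → ℝ) (F' : PathIdx G → ℝ) : Prop :=
  (∀ q, 0 ≤ F' q) ∧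
    ∃ φ : {x // x ∈ B} → V, Function.Injective φ ∧
      ∀ u v : {x // x ∈ B}, u ≠ v →
        (∑ S ∈ univ.filter (fun S : Finset V => u.1 ∈ S ∧ v.1 ∈ S), μ S) ≤
          flowAmt G F' (φ u) (φ v)

/-- `inter_G(H_μ)`: the minimum intersection number over all `H_μ`-flows in `G`. -/
noncomputable def interG [Fintype V] [DecidableEq V] (G : SimpleGraph V) [DecidableRel G.Adj]
    (B : Finset V) (μ : Finset V → ℝ) : ℝ :=
  sInf {I : ℝ | ∃ F' : PathIdx G → ℝ, IsHMuFlow G B μ F' ∧ I = inter G F'}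

theorem inter_nonneg_aux [Fintype V] [DecidableEq V] (G : SimpleGraph V) [DecidableRel G.Adj]
    (F : PathIdx G → ℝ) (hF : ∀ q, 0 ≤ F q) : 0 ≤ inter G F := by
  unfold inter
  refine Finset.sum_nonneg fun q _ => Finset.sum_nonneg fun q' _ => ?_
  split_ifs
  · exact mul_nonneg (mul_nonneg (Nat.cast_nonneg _) (hF q)) (hF q')
  · exact le_rfl

theorem con_eq_aux [Fintype V] [DecidableEq V] (G : SimpleGraph V) [DecidableRel G.Adj]
    (F : PathIdx G → ℝ) : con G F = ∑ q : PathIdx G, ∑ q' : PathIdx G,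
      (((q.2.2 : G.Walk q.1 q.2.1).support.toFinset ∩
          (q'.2.2 : G.Walk q'.1 q'.2.1).support.toFinset).card : ℝ) * F q * F q' := by
  unfold con vertexCongestion
  simp_rw [sq, Finset.sum_mul_sum]
  rw [Finset.sum_comm]
  refine Finset.sum_congr rfl fun q _ => ?_
  rw [Finset.sum_comm]
  refine Finset.sum_congr rfl fun q' _ => ?_
  rw [mul_assoc, ← nsmul_eq_mul, ← Finset.sum_const,
    ← Finset.sum_subset (Finset.subset_univ ((q.2.2 : G.Walk q.1 q.2.1).support.toFinset ∩
          (q'.2.2 : G.Walk q'.1 q'.2.1).support.toFinset))]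
  · refine Finset.sum_congr rfl fun x hx => ?_
    simp only [Finset.mem_inter, List.mem_toFinset] at hx
    rw [if_pos hx.1, if_pos hx.2]
  · intro x _ hx
    simp only [Finset.mem_inter, List.mem_toFinset, not_and] at hx
    by_cases h : x ∈ (q.2.2 : G.Walk q.1 q.2.1).support
    · rw [if_neg (hx h), mul_zero]
    · rw [if_neg h, zero_mul]

/-- If `F ∈ ℱ_r(G, B)` is a `μ`-flow for a distribution `μ` supported on `r`-element subsets
of `B`, then `inter_G(H_μ) ≤ con(F)`. -/
theorem interG_le_con [Fintype V] [DecidableEq V]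
    (G : SimpleGraph V) [DecidableRel G.Adj] (hG : G.Connected)
    (B : Finset V) (hB : IsBoundary G B)
    (r : ℕ) (hr2 : 2 ≤ r) (hrB : r ≤ B.card)
    (F : PathIdx G → ℝ) (hFpos : ∀ q, 0 ≤ F q)
    (μ : Finset V → ℝ) (hμ0 : ∀ S, 0 ≤ μ S) (hμ1 : (∑ S : Finset V, μ S) = 1)
    (hμsupp : ∀ S, μ S ≠ 0 → S ⊆ B ∧ S.card = r)
    (hμF : IsMuFlow G F μ) :
    interG G B μ ≤ con G F := by
  have h1 : interG G B μ ≤ inter G F := by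
    refine csInf_le ⟨0, ?_⟩ ⟨F, ⟨hFpos, Subtype.val, Subtype.val_injective, ?_⟩, rfl⟩
    · rintro I ⟨F', hF', rfl⟩
      exact inter_nonneg_aux G F' hF'.1
    · intro u v _
      exact (hμF u.1 v.1).ge
  refine h1.trans ?_
  rw [con_eq_aux]
  unfold inter
  refine Finset.sum_le_sum fun q _ => Finset.sum_le_sum fun q' _ => ?_
  split_ifs
  · exact le_rfl
  · exact mul_nonneg (mul_nonneg (Nat.cast_nonneg _) (hFpos q)) (hFpos q')
end
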